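/- Let I be a left ideal of Ŝ such that Ŝ/I is a faithful 1-critical left Ŝ-module. Then I = Ŝz for an irreducible element z of Ŝ, which necessarily has type (C). The analogous statement holds for right ideals: if Ŝ/I is a faithful 1-critical right Ŝ-module for a right ideal I, then I = zŜ for a (type (C)) irreducible element z of Ŝ. -/

import Mathlib

open MulOpposite

universe u

/-- `φ : R →+* S` and `θ : S` exhibit `S` as the skew polynomial ring `R[θ; α]`:
`θ · r = α(r) · θ`, and every element of `S` is uniquely a polynomial `Σ rᵢ θ^i`. -/
structure IsSkewPolynomialRing {R S : Type u} [CommRing R] [Ring S]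
    (α : R ≃+* R) (φ : R →+* S) (θ : S) : Prop where
  commutes : ∀ r : R, θ * φ r = φ (α r) * θ
  bijective : Function.Bijective fun p : ℕ →₀ R => p.sum fun n r => φ r * θ ^ n

/-- `ψ : S →+* T` exhibits `T` as the (Ore) localization of `S` inverting the
powers of the normal element `x`. -/
structure IsLocalizationAt {S T : Type u} [Ring S] [Ring T] (x : S) (ψ : S →+* T) : Prop where
  inj : Function.Injective ψ
  unit : IsUnit (ψ x)
  surj : ∀ t : T, ∃ (s : S) (n : ℕ), t * ψ x ^ n = ψ s

/-- The right ideal `zS`. -/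
abbrev rSpan (S : Type u) [Ring S] (z : S) : Submodule Sᵐᵒᵖ S := Submodule.span Sᵐᵒᵖ {z}

/-- The left ideal `Sz`. -/
abbrev lSpan (S : Type u) [Ring S] (z : S) : Submodule S S := Submodule.span S {z}

/-- The cyclic right `S`-module `S/zS`. -/
abbrev rQuot (S : Type u) [Ring S] (z : S) : Type u := S ⧸ rSpan S z

/-- The cyclic left `S`-module `S/Sz`. -/
abbrev lQuot (S : Type u) [Ring S] (z : S) : Type u := S ⧸ lSpan S z

/-- The cyclic right `S`-module `S/(aS + bS)`. -/
abbrev rQuot2 (S : Type u) [Ring S] (a b : S) : Type u := S ⧸ (rSpan S a ⊔ rSpan S b)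

/-- Two elements of `T` are similar if `T/aT ≅ T/bT` as right `T`-modules. -/
def SimilarIn (T : Type u) [Ring T] (a b : T) : Prop :=
  Nonempty (rQuot T a ≃ₗ[Tᵐᵒᵖ] rQuot T b)

/-- The image in `S` of a polynomial `p ∈ k[θ]`, i.e. `Σ φ(pᵢ) θ^i`. -/
def thetaPoly {k R S : Type u} [CommSemiring k] [CommRing R] [Ring S] [Algebra k R]
    (φ : R →+* S) (θ : S) (p : Polynomial k) : S :=
  p.sum fun n c => φ (algebraMap k R c) * θ ^ n

/-- Type (A) irreducibles of `S = R[θ; α]`: unit multiples of `X` or `θ`. -/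
def IsTypeA {R S : Type u} [CommRing R] [Ring S] (X : R) (φ : R →+* S) (θ : S) (z : S) : Prop :=
  ∃ u : Sˣ, (u : S) * z = φ X ∨ (u : S) * z = θ

/-- Type (B) irreducibles of `S = R[θ; α]`: unit multiples of `1 + Xs`, `s ∈ S∖R`. -/
def IsTypeB {R S : Type u} [CommRing R] [Ring S] (X : R) (φ : R →+* S) (z : S) : Prop :=
  ∃ (u : Sˣ) (s : S), s ∉ Set.range φ ∧ (u : S) * z = 1 + φ X * s

/-- Type (C) irreducibles of `S = R[θ; α]`: unit multiples of `f + Xs` with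
`f ∈ k[θ]∖k` monic and the element not equal to `θ`. -/
def IsTypeC (k : Type u) {R S : Type u} [CommSemiring k] [CommRing R] [Ring S] [Algebra k R]
    (X : R) (φ : R →+* S) (θ : S) (z : S) : Prop :=
  ∃ (u : Sˣ) (p : Polynomial k) (s : S), p.Monic ∧ 1 ≤ p.natDegree ∧
    (u : S) * z = thetaPoly φ θ p + φ X * s ∧ (u : S) * z ≠ θ

/-- A module is locally Artinian if all its finitely generated submodules are Artinian. -/
def IsLocallyArtinian (A M : Type u) [Ring A] [AddCommGroup M] [Module A M] : Prop :=
  ∀ N : Submodule A M, N.FG → IsArtinian A N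

/-- A submodule is essential if it meets every nonzero submodule nontrivially. -/
def IsEssentialSubmodule {A : Type u} [Ring A] {E : Type u} [AddCommGroup E] [Module A E]
    (U : Submodule A E) : Prop :=
  ∀ W : Submodule A E, W ≠ ⊥ → W ⊓ U ≠ ⊥

/-- `f : V →ₗ[A] E` exhibits `E` as an injective hull of `V`. -/
def IsInjectiveHullVia (A : Type u) [Ring A] {V E : Type u} [AddCommGroup V] [Module A V]
    [AddCommGroup E] [Module A E] (f : V →ₗ[A] E) : Prop :=
  Module.Injective A E ∧ Function.Injective f ∧ IsEssentialSubmodule (LinearMap.range f)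

/-- Property (◊) for left `A`-modules: the injective hull of every simple left `A`-module
is locally Artinian.  (Apply with `A = Sᵐᵒᵖ` for the right-module version.) -/
def HasDiamond (A : Type u) [Ring A] : Prop :=
  ∀ (V E : Type u) [AddCommGroup V] [Module A V] [AddCommGroup E] [Module A E]
    (f : V →ₗ[A] E), IsSimpleModule A V → IsInjectiveHullVia A f → IsLocallyArtinian A E

/-- Gabriel–Rentschler Krull dimension at most `n`; the base case `n = 0` is
`Artinian`, and `Kdim M ≤ n + 1` iff in every descending chain of submodules almost
all successive factors have Krull dimension at most `n`. -/
def KdimLE (A : Type u) [Ring A] : ℕ → ∀ (M : Type u) [AddCommGroup M] [Module A M], Prop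
  | 0, M, _, _ => IsArtinian A M
  | n + 1, M, _, _ =>
      ∀ f : ℕ → Submodule A M, (∀ i, f (i + 1) ≤ f i) →
        ∃ N : ℕ, ∀ i, N ≤ i →
          KdimLE A n (↥(f i) ⧸ Submodule.comap (f i).subtype (f (i + 1)))

/-- A `1`-critical module: Krull dimension exactly `1`, and all proper factors of
Krull dimension `< 1`, i.e. Artinian. -/
def IsOneCritical (A : Type u) [Ring A] (M : Type u) [AddCommGroup M] [Module A M] : Prop :=
  KdimLE A 1 M ∧ ¬ IsArtinian A M ∧ ∀ N : Submodule A M, N ≠ ⊥ → IsArtinian A (M ⧸ N)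

/-- A right `S`-module is `𝒳`-torsion free (`𝒳 = {xⁿ}`). -/
def IsXTorsionFree {S : Type u} [Ring S] (x : S) (M : Type u) [AddCommGroup M]
    [Module Sᵐᵒᵖ M] : Prop :=
  ∀ (m : M) (n : ℕ), op (x ^ n) • m = 0 → m = 0

/-- A right `S`-module is `𝒳`-torsion (`𝒳 = {xⁿ}`). -/
def IsXTorsion {S : Type u} [Ring S] (x : S) (M : Type u) [AddCommGroup M]
    [Module Sᵐᵒᵖ M] : Prop :=
  ∀ m : M, ∃ n : ℕ, op (x ^ n) • m = 0

/-- The central embedding of `k` into `Sᵐᵒᵖ` coming from `k → R → S`. -/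
def opScalars {k R S : Type u} [CommSemiring k] [CommRing R] [Ring S] [Algebra k R]
    (φ : R →+* S) : k →+* Sᵐᵒᵖ where
  toFun c := op (φ (algebraMap k R c))
  map_one' := by simp
  map_mul' x y := by
    show op (φ (algebraMap k R (x * y))) = op (φ (algebraMap k R x)) * op (φ (algebraMap k R y))
    rw [mul_comm x y, map_mul, map_mul, op_mul]
  map_zero' := by simp
  map_add' x y := by
    show op (φ (algebraMap k R (x + y))) = op (φ (algebraMap k R x)) + op (φ (algebraMap k R y))
    rw [map_add, map_add, op_add]

/-- A right `S`-module is finite dimensional over the central subfield `k`. -/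
def FinDimOver (k : Type u) {R S : Type u} [Field k] [CommRing R] [Ring S] [Algebra k R]
    (φ : R →+* S) (M : Type u) [AddCommGroup M] [Module Sᵐᵒᵖ M] : Prop :=
  letI : Module k M := Module.compHom M (opScalars φ)
  Module.Finite k M

/-- A left `S`-module is finite dimensional over the central subfield `k`. -/
def FinDimOverLeft (k : Type u) {R S : Type u} [Field k] [CommRing R] [Ring S] [Algebra k R]
    (φ : R →+* S) (M : Type u) [AddCommGroup M] [Module S M] : Prop :=
  letI : Module k M := Module.compHom M (φ.comp (algebraMap k R))
  Module.Finite k M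

/-- `Ext¹_A(U, V) = 0`: every short exact sequence `0 → V → Y → U → 0` splits. -/
def ExtVanish (A : Type u) [Ring A] (U V : Type u) [AddCommGroup U] [Module A U]
    [AddCommGroup V] [Module A V] : Prop :=
  ∀ (Y : Type u) [AddCommGroup Y] [Module A Y] (i : V →ₗ[A] Y) (p : Y →ₗ[A] U),
    Function.Injective i → Function.Surjective p → LinearMap.range i = LinearMap.ker p →
    ∃ r : Y →ₗ[A] V, r.comp i = LinearMap.id

/-- The right `S`-module `V` is isomorphic, as an `S`-module, to the right `T`-module `Q`
(`T` an `S`-ring via `ψ`). -/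
def SModIsoOfT {S T : Type u} [Ring S] [Ring T] (ψ : S →+* T)
    (V : Type u) [AddCommGroup V] [Module Sᵐᵒᵖ V]
    (Q : Type u) [AddCommGroup Q] [Module Tᵐᵒᵖ Q] : Prop :=
  ∃ e : V ≃+ Q, ∀ (s : S) (v : V), e (op s • v) = op (ψ s) • e v

/-- Two modules are hull-similar: they contain nonzero isomorphic submodules
(equivalently, their injective hulls are isomorphic). -/
def HullSimilar (A : Type u) [Ring A] (M N : Type u) [AddCommGroup M] [Module A M]
    [AddCommGroup N] [Module A N] : Prop :=
  ∃ (P : Submodule A M) (Q : Submodule A N), P ≠ ⊥ ∧ Q ≠ ⊥ ∧ Nonempty (P ≃ₗ[A] Q)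

/-- Restriction of scalars along `ψ : S →+* T` for right modules. -/
def restrictOp {S T : Type u} [Ring S] [Ring T] (ψ : S →+* T)
    (E : Type u) [AddCommGroup E] [Module Tᵐᵒᵖ E] : Module Sᵐᵒᵖ E :=
  Module.compHom E (RingHom.op ψ)

/-- `f : V →+ E` exhibits `E` as an injective hull of the `A`-module `V`,
where `f` is additionally required to be `A`-linear. -/
def IsInjectiveHullViaAdd (A : Type u) [Ring A] {V E : Type u} [AddCommGroup V] [Module A V]
    [AddCommGroup E] [Module A E] (f : V →+ E) : Prop :=
  Module.Injective A E ∧ Function.Injective f ∧ (∀ (a : A) (v : V), f (a • v) = a • f v) ∧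
    ∀ W : Submodule A E, W ≠ ⊥ → ∃ x : E, x ≠ 0 ∧ x ∈ W ∧ x ∈ Set.range f

noncomputable section SkewAux

variable {k : Type u} [Field k] {α : PowerSeries k ≃+* PowerSeries k}
  {S : Type u} [Ring S] {φ : PowerSeries k →+* S} {θ : S}

theorem IsSkewPolynomialRing.bij (hS : IsSkewPolynomialRing α φ θ) :
    Function.Bijective (Polynomial.eval₂ φ θ) := by
  have h := hS.bijective
  have key : ∀ p : Polynomial (PowerSeries k), Polynomial.eval₂ φ θ p =
      (Finsupp.mk p.support p.coeff (by simp) : ℕ →₀ PowerSeries k).sum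
        fun n r => φ r * θ ^ n := by
    intro p
    rw [Polynomial.eval₂_eq_sum, Polynomial.sum, Finsupp.sum]
    rfl
  constructor
  · intro p q hpq
    rw [key, key] at hpq
    have := h.1 hpq
    ext1 n
    exact DFunLike.congr_fun this n
  · intro s
    obtain ⟨f, hf⟩ := h.2 s
    refine ⟨∑ n ∈ f.support, Polynomial.monomial n (f n), ?_⟩
    rw [Polynomial.eval₂_finsetSum]
    simp only [Polynomial.eval₂_monomial]
    exact hf

/-- the polynomial representing an element -/
def skRep (hS : IsSkewPolynomialRing α φ θ) : S ≃+ Polynomial (PowerSeries k) :=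
  (AddEquiv.ofBijective (Polynomial.eval₂AddMonoidHom φ θ) hS.bij).symm

variable (hS : IsSkewPolynomialRing α φ θ)

theorem skRep_eval (p : Polynomial (PowerSeries k)) : skRep hS (Polynomial.eval₂ φ θ p) = p :=
  (AddEquiv.ofBijective (Polynomial.eval₂AddMonoidHom φ θ) hS.bij).symm_apply_apply p

theorem eval_skRep (s : S) : Polynomial.eval₂ φ θ (skRep hS s) = s :=
  (AddEquiv.ofBijective (Polynomial.eval₂AddMonoidHom φ θ) hS.bij).apply_symm_apply s

include hS in
theorem sk_induction {P : S → Prop} (hadd : ∀ a b, P a → P b → P (a + b))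
    (hm : ∀ a r, P a → P (φ r * a)) (h1 : P 1) (ht : ∀ a, P a → P (θ * a)) (s : S) : P s := by
  have hpow : ∀ n : ℕ, P (θ ^ n) := by
    intro n
    induction n with
    | zero => simpa using h1
    | succ n ih => rw [pow_succ']; exact ht _ ih
  rw [← eval_skRep hS s]
  induction skRep hS s using Polynomial.induction_on' with
  | add p q hp hq => rw [Polynomial.eval₂_add]; exact hadd _ _ hp hq
  | monomial n r => rw [Polynomial.eval₂_monomial]; exact hm _ _ (hpow n)

theorem skRep_φ_mul (r : PowerSeries k) (s : S) :
    skRep hS (φ r * s) = Polynomial.C r * skRep hS s := by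
  apply hS.bij.1
  rw [eval_skRep]
  conv_lhs => rw [← eval_skRep hS s]
  induction skRep hS s using Polynomial.induction_on' with
  | add p q hp hq => rw [Polynomial.eval₂_add, mul_add, mul_add, hp, hq, Polynomial.eval₂_add]
  | monomial n r =>
    rw [Polynomial.C_mul_monomial, Polynomial.eval₂_monomial, Polynomial.eval₂_monomial, map_mul,
      mul_assoc]

theorem skRep_θ_mul (s : S) :
    skRep hS (θ * s) = (skRep hS s).map (α : PowerSeries k →+* PowerSeries k) * Polynomial.X := by
  apply hS.bij.1
  rw [eval_skRep]
  conv_lhs => rw [← eval_skRep hS s]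
  induction skRep hS s using Polynomial.induction_on' with
  | add p q hp hq =>
    rw [Polynomial.eval₂_add, mul_add, Polynomial.map_add, add_mul, hp, hq, Polynomial.eval₂_add]
  | monomial n r =>
    rw [Polynomial.map_monomial, Polynomial.monomial_mul_X, Polynomial.eval₂_monomial,
      Polynomial.eval₂_monomial, ← mul_assoc, hS.commutes, mul_assoc, pow_succ']
    rfl

theorem skRep_one : skRep hS 1 = 1 := by
  rw [← skRep_eval hS 1, Polynomial.eval₂_one]

theorem skRep_φ (r : PowerSeries k) : skRep hS (φ r) = Polynomial.C r := by
  rw [← skRep_eval hS (Polynomial.C r), Polynomial.eval₂_C]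

theorem skRep_θ : skRep hS θ = Polynomial.X := by
  rw [← skRep_eval hS (Polynomial.X), Polynomial.eval₂_X]

theorem skRep_pow_mul (j : ℕ) (s : S) : skRep hS (θ ^ j * s) =
    (skRep hS s).map ((α ^ j : PowerSeries k ≃+* PowerSeries k) : PowerSeries k →+* PowerSeries k)
      * Polynomial.X ^ j := by
  induction j with
  | zero => ext1 n; simp
  | succ n ih =>
    rw [pow_succ', mul_assoc, skRep_θ_mul, ih]
    simp only [Polynomial.map_mul, Polynomial.map_pow, Polynomial.map_X, Polynomial.map_map]
    rw [mul_assoc, ← pow_succ, pow_succ' α]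
    rfl

include hS in
theorem sk_nontrivial : Nontrivial S := (skRep hS).toEquiv.nontrivial

/-- degree -/
def skDeg (s : S) : ℕ := (skRep hS s).natDegree

theorem skRep_ne {s : S} (h : s ≠ 0) : skRep hS s ≠ 0 := by
  simpa using h

theorem skDeg_mul_le (a b : S) : skDeg hS (a * b) ≤ skDeg hS a + skDeg hS b := by
  have : ∀ p : Polynomial (PowerSeries k), skDeg hS (Polynomial.eval₂ φ θ p * b) ≤
      p.natDegree + skDeg hS b := by
    intro p
    rw [Polynomial.eval₂_eq_sum_range, Finset.sum_mul]
    unfold skDeg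
    rw [map_sum]
    apply Polynomial.natDegree_sum_le_of_forall_le
    intro i hi
    rw [mul_assoc, skRep_φ_mul, skRep_pow_mul]
    refine (Polynomial.natDegree_C_mul_le _ _).trans ?_
    refine Polynomial.natDegree_mul_le.trans ?_
    rw [Polynomial.natDegree_X_pow]
    have := Polynomial.natDegree_map_le (p := skRep hS b)
      (f := ((α ^ i : PowerSeries k ≃+* PowerSeries k) : PowerSeries k →+* PowerSeries k))
    simp at hi
    omega
  have h := this (skRep hS a)
  rwa [eval_skRep] at h

theorem sk_lead (r : PowerSeries k) (j : ℕ) (b : S) :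
    (skRep hS (φ r * θ ^ j * b)).coeff (j + skDeg hS b) =
      r * (α ^ j : PowerSeries k ≃+* PowerSeries k) (skRep hS b).leadingCoeff := by
  rw [mul_assoc, skRep_φ_mul, skRep_pow_mul, Polynomial.coeff_C_mul, add_comm j,
    Polynomial.coeff_mul_X_pow, Polynomial.coeff_map]
  rfl

include hS in
theorem sk_noZeroDivisors : NoZeroDivisors S := by
  refine ⟨fun {a b} hab => ?_⟩
  by_contra! hc
  obtain ⟨ha, hb⟩ := hc
  set p := skRep hS a with hp
  have hp0 : p ≠ 0 := skRep_ne hS ha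
  have hq0 := skRep_ne hS hb
  have e : a = φ p.leadingCoeff * θ ^ p.natDegree + Polynomial.eval₂ φ θ p.eraseLead := by
    conv_lhs => rw [← eval_skRep hS a, ← hp, ← p.eraseLead_add_monomial_natDegree_leadingCoeff]
    rw [Polynomial.eval₂_add, Polynomial.eval₂_monomial, add_comm]
  have h1 := congrArg (fun s => (skRep hS s).coeff (p.natDegree + skDeg hS b)) hab
  simp only [map_zero, Polynomial.coeff_zero] at h1
  have hl : p.leadingCoeff * (α ^ p.natDegree : PowerSeries k ≃+* PowerSeries k)
      (skRep hS b).leadingCoeff ≠ 0 := by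
    apply mul_ne_zero
    · simpa using hp0
    · rw [ne_eq, map_eq_zero_iff _ (RingEquiv.injective _)]
      simpa using hq0
  apply hl
  rw [← sk_lead, ← h1, e, add_mul, map_add, Polynomial.coeff_add, left_eq_add]
  by_cases h0 : p.eraseLead = 0
  · rw [h0]; simp
  by_cases hd : p.natDegree = 0
  · exfalso; apply h0
    rw [Polynomial.eq_C_of_natDegree_eq_zero hd]
    simp
  apply Polynomial.coeff_eq_zero_of_natDegree_lt
  have := skDeg_mul_le hS (Polynomial.eval₂ φ θ p.eraseLead) b
  have h3 := Polynomial.eraseLead_natDegree_le p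
  have h4 : skDeg hS (Polynomial.eval₂ φ θ p.eraseLead) = p.eraseLead.natDegree := by
    rw [skDeg, skRep_eval]
  unfold skDeg at *
  omega

/-- reduction mod `X` -/
def skπ (s : S) : Polynomial k := (skRep hS s).map PowerSeries.constantCoeff

theorem α_const (r : PowerSeries k) (hα : ∀ c, α (PowerSeries.C c) = PowerSeries.C c) :
    PowerSeries.constantCoeff (α r) = PowerSeries.constantCoeff r := by
  have h : ∀ t : PowerSeries k, PowerSeries.constantCoeff t = 0 →
      PowerSeries.constantCoeff (α t) = 0 := by
    intro t ht
    by_contra hc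
    have h1 : IsUnit (α t) := PowerSeries.isUnit_iff_constantCoeff.2 (isUnit_iff_ne_zero.2 hc)
    have h2 : IsUnit t := by simpa using h1
    have := PowerSeries.isUnit_iff_constantCoeff.1 h2
    rw [ht] at this
    simp at this
  have := h (r - PowerSeries.C (PowerSeries.constantCoeff r)) (by simp)
  rw [map_sub, hα, map_sub] at this
  simpa [sub_eq_zero] using this

/-- reduction as ring hom -/
def skPi (hα : ∀ c, α (PowerSeries.C c) = PowerSeries.C c) : S →+* Polynomial k where
  toFun := skπ hS
  map_zero' := by simp [skπ]
  map_one' := by simp [skπ, skRep_one]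
  map_add' a b := by simp [skπ]
  map_mul' a b := by
    induction a using sk_induction hS with
    | hadd a a' h h' =>
      rw [add_mul]
      unfold skπ at *
      simp only [map_add, Polynomial.map_add, h, h', add_mul]
    | hm a r h =>
      unfold skπ at *
      rw [mul_assoc, skRep_φ_mul, Polynomial.map_mul, h, skRep_φ_mul, Polynomial.map_mul, mul_assoc]
    | h1 => simp [skπ, skRep_one]
    | ht a h =>
      have : ∀ s, skπ hS (θ * s) = skπ hS s * Polynomial.X := by
        intro s
        unfold skπ
        rw [skRep_θ_mul, Polynomial.map_mul, Polynomial.map_X, Polynomial.map_map]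
        congr 2
        ext1 r
        exact α_const r hα
      rw [mul_assoc, this, this, h]
      ring

variable (hα : ∀ c, α (PowerSeries.C c) = PowerSeries.C c)

theorem skPi_φ (r : PowerSeries k) :
    skPi hS hα (φ r) = Polynomial.C (PowerSeries.constantCoeff r) := by
  show skπ hS _ = _
  rw [skπ, skRep_φ, Polynomial.map_C]

theorem skPi_X : skPi hS hα (φ PowerSeries.X) = 0 := by
  rw [skPi_φ]; simp

theorem skPi_θ : skPi hS hα θ = Polynomial.X := by
  show skπ hS _ = _
  rw [skπ, skRep_θ, Polynomial.map_X]

theorem skPi_ker {s : S} (h : skPi hS hα s = 0) : ∃ t, s = φ PowerSeries.X * t := by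
  change (skRep hS s).map _ = 0 at h
  have : Polynomial.C (PowerSeries.X : PowerSeries k) ∣ skRep hS s := by
    rw [Polynomial.C_dvd_iff_dvd_coeff]
    intro i
    rw [PowerSeries.X_dvd_iff, ← Polynomial.coeff_map, h, Polynomial.coeff_zero]
  obtain ⟨q, hq⟩ := this
  refine ⟨Polynomial.eval₂ φ θ q, ?_⟩
  apply (skRep hS).injective
  rw [skRep_φ_mul, skRep_eval, hq]

theorem skPi_thetaPoly (p : Polynomial k) : skPi hS hα (thetaPoly φ θ p) = p := by
  unfold thetaPoly
  rw [Polynomial.sum, map_sum]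
  simp only [map_mul, map_pow, skPi_φ, skPi_θ]
  conv_rhs => rw [p.as_sum_support_C_mul_X_pow]
  rfl

/-- normal elements -/
def SkNormal {A : Type u} [Ring A] (w : A) : Prop :=
  (∀ s, ∃ s', s * w = w * s') ∧ (∀ s, ∃ s', w * s = s' * w)

theorem SkNormal.pow {A : Type u} [Ring A] {w : A} (h : SkNormal w) (n : ℕ) :
    SkNormal (w ^ n) := by
  induction n with
  | zero => exact ⟨fun s => ⟨s, by simp⟩, fun s => ⟨s, by simp⟩⟩
  | succ n ih =>
    constructor
    · intro s
      obtain ⟨a, ha⟩ := ih.1 s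
      obtain ⟨b, hb⟩ := h.1 a
      exact ⟨b, by rw [pow_succ, ← mul_assoc, ha, mul_assoc, hb, mul_assoc]⟩
    · intro s
      obtain ⟨a, ha⟩ := h.2 s
      obtain ⟨b, hb⟩ := ih.2 a
      exact ⟨b, by rw [pow_succ, mul_assoc, ha, ← mul_assoc, hb, mul_assoc]⟩

include hS in
theorem skNormal_θ : SkNormal θ := by
  constructor
  · intro s
    induction s using sk_induction hS with
    | hadd a b h h' =>
      obtain ⟨a', h⟩ := h
      obtain ⟨b', h'⟩ := h'
      exact ⟨a' + b', by rw [add_mul, h, h', mul_add]⟩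
    | hm a r h =>
      obtain ⟨a', h⟩ := h
      refine ⟨φ (α.symm r) * a', ?_⟩
      rw [← mul_assoc, hS.commutes, mul_assoc, h, RingEquiv.apply_symm_apply, mul_assoc]
    | h1 => exact ⟨1, by simp⟩
    | ht a h =>
      obtain ⟨a', h⟩ := h
      exact ⟨θ * a', by rw [mul_assoc, h]⟩
  · intro s
    induction s using sk_induction hS with
    | hadd a b h h' =>
      obtain ⟨a', h⟩ := h
      obtain ⟨b', h'⟩ := h'
      exact ⟨a' + b', by rw [mul_add, h, h', add_mul]⟩
    | hm a r h =>
      obtain ⟨a', h⟩ := h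
      refine ⟨φ (α r) * a', ?_⟩
      rw [← mul_assoc, hS.commutes, mul_assoc, h, mul_assoc]
    | h1 => exact ⟨1, by simp⟩
    | ht a h =>
      obtain ⟨a', h⟩ := h
      exact ⟨θ * a', by rw [h, mul_assoc]⟩

include hS hα in
theorem skNormal_X : SkNormal (φ PowerSeries.X) := by
  have hα' : ∀ c, α.symm (PowerSeries.C c) = PowerSeries.C c := by
    intro c; rw [RingEquiv.symm_apply_eq, hα]
  obtain ⟨q, hq⟩ : (PowerSeries.X : PowerSeries k) ∣ α PowerSeries.X := by
    rw [PowerSeries.X_dvd_iff, α_const _ hα]; simp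
  obtain ⟨q', hq'⟩ : (PowerSeries.X : PowerSeries k) ∣ α.symm PowerSeries.X := by
    rw [PowerSeries.X_dvd_iff, α_const _ hα']; simp
  have hq'' : PowerSeries.X = α q' * α PowerSeries.X := by
    rw [← map_mul, mul_comm, ← hq', RingEquiv.apply_symm_apply]
  have hc : ∀ r, φ r * φ PowerSeries.X = φ PowerSeries.X * φ r := by
    intro r; rw [← map_mul, mul_comm, map_mul]
  constructor
  · intro s
    induction s using sk_induction hS with
    | hadd a b h h' =>
      obtain ⟨a', h⟩ := h
      obtain ⟨b', h'⟩ := h'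
      exact ⟨a' + b', by rw [add_mul, h, h', mul_add]⟩
    | hm a r h =>
      obtain ⟨a', h⟩ := h
      refine ⟨φ r * a', ?_⟩
      rw [mul_assoc, h, ← mul_assoc, hc, mul_assoc]
    | h1 => exact ⟨1, by simp⟩
    | ht a h =>
      obtain ⟨a', h⟩ := h
      refine ⟨φ q * (θ * a'), ?_⟩
      rw [mul_assoc, h, ← mul_assoc, hS.commutes]
      show φ (α PowerSeries.X) * θ * a' = _
      rw [hq, map_mul]
      simp only [mul_assoc]
  · intro s
    induction s using sk_induction hS with
    | hadd a b h h' =>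
      obtain ⟨a', h⟩ := h
      obtain ⟨b', h'⟩ := h'
      exact ⟨a' + b', by rw [mul_add, h, h', add_mul]⟩
    | hm a r h =>
      obtain ⟨a', h⟩ := h
      refine ⟨φ r * a', ?_⟩
      rw [← mul_assoc, ← hc, mul_assoc, h, mul_assoc]
    | h1 => exact ⟨1, by simp⟩
    | ht a h =>
      obtain ⟨a', h⟩ := h
      refine ⟨φ (α q') * (θ * a'), ?_⟩
      rw [mul_assoc, mul_assoc, ← h, ← mul_assoc θ, hS.commutes]
      show _ = φ (α q') * (φ (α PowerSeries.X) * θ * a)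
      conv_lhs => rw [hq'', map_mul]
      simp only [mul_assoc]

/-- multiples of a normal element -/
def wRange {A M : Type u} [Ring A] [AddCommGroup M] [Module A M] {w : A} (hw : SkNormal w) :
    Submodule A M where
  carrier := {m | ∃ m', w • m' = m}
  zero_mem' := ⟨0, by simp⟩
  add_mem' := by
    rintro _ _ ⟨a, rfl⟩ ⟨b, rfl⟩
    exact ⟨a + b, by simp⟩
  smul_mem' := by
    rintro s _ ⟨a, rfl⟩
    obtain ⟨s', h⟩ := hw.1 s
    exact ⟨s' • a, by rw [smul_smul, smul_smul, h]⟩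

/-- preimage under a normal element -/
def wComap {A M : Type u} [Ring A] [AddCommGroup M] [Module A M] {w : A} (hw : SkNormal w)
    (N : Submodule A M) : Submodule A M where
  carrier := {m | w • m ∈ N}
  zero_mem' := by simp
  add_mem' := by
    intro a b ha hb
    simp only [Set.mem_ofPred_eq, smul_add] at *
    exact N.add_mem ha hb
  smul_mem' := by
    intro s m hm
    obtain ⟨s', h⟩ := hw.2 s
    simp only [Set.mem_ofPred_eq] at *
    rw [smul_smul, h, ← smul_smul]
    exact N.smul_mem _ hm

theorem artin_surj {A M : Type u} [Ring A] [AddCommGroup M] [Module A M] [IsArtinian A M] {w : A}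
    (hw : SkNormal w) (hinj : ∀ m : M, w • m = 0 → m = 0) (m : M) : ∃ m', w • m' = m := by
  let f : ℕ →o (Submodule A M)ᵒᵈ := ⟨fun n => OrderDual.toDual (wRange (hw.pow n)), by
    apply monotone_nat_of_le_succ
    intro n
    show wRange (hw.pow (n+1)) ≤ wRange (hw.pow n)
    rintro _ ⟨a, rfl⟩
    exact ⟨w • a, by rw [smul_smul, pow_succ]⟩⟩
  obtain ⟨n, hn⟩ := IsArtinian.monotone_stabilizes f
  have h1 : (wRange (hw.pow n) : Submodule A M) = wRange (hw.pow (n+1)) := hn (n+1) (by omega)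
  have h2 : w ^ n • m ∈ (wRange (hw.pow (n+1)) : Submodule A M) := by
    rw [← h1]; exact ⟨m, rfl⟩
  obtain ⟨a, ha⟩ := h2
  refine ⟨a, ?_⟩
  have h3 : ∀ j : ℕ, ∀ b : M, w ^ j • b = 0 → b = 0 := by
    intro j
    induction j with
    | zero => intro b hb; simpa using hb
    | succ j ih =>
      intro b hb
      rw [pow_succ, mul_smul] at hb
      exact hinj _ (ih _ hb)
  rw [← sub_eq_zero]
  apply h3 n
  rw [smul_sub, ← ha, pow_succ, mul_smul, sub_self]

theorem crit_not_artin {A M : Type u} [Ring A] [AddCommGroup M] [Module A M]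
    (hM : IsOneCritical A M) (N : Submodule A M) (hN : IsArtinian A N) : N = ⊥ := by
  by_contra h
  have := hM.2.2 N h
  apply hM.2.1
  exact isArtinian_of_range_eq_ker N.subtype N.mkQ (by simp)

theorem crit_inj {A M : Type u} [Ring A] [AddCommGroup M] [Module A M]
    (hM : IsOneCritical A M) {w : A} (hw : SkNormal w) (h0 : ∃ m : M, w • m ≠ 0)
    (m : M) (hm : w • m = 0) : m = 0 := by
  by_contra hne
  have h1 : wComap hw (⊥ : Submodule A M) ≠ ⊥ := by
    intro h
    apply hne
    have : m ∈ wComap hw (⊥ : Submodule A M) := hm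
    rw [h] at this
    simpa using this
  have h2 := hM.2.2 _ h1
  have h3 : IsArtinian A (wRange hw : Submodule A M) := by
    let F : Submodule A (wRange hw : Submodule A M) → Submodule A (M ⧸ wComap hw ⊥) :=
      fun P => (wComap hw (P.map (Submodule.subtype _))).map (Submodule.mkQ _)
    have hF : StrictMono F := by
      apply Monotone.strictMono_of_injective
      · intro P Q hPQ
        apply Submodule.map_mono
        intro a ha
        exact Submodule.map_mono hPQ ha
      · intro P Q hPQ
        have h4 := congrArg (Submodule.comap (Submodule.mkQ _)) hPQ
        simp only [F, Submodule.comap_map_mkQ] at h4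
        have hle : ∀ P : Submodule A (wRange hw : Submodule A M),
            wComap hw ⊥ ≤ wComap hw (P.map (Submodule.subtype _)) := by
          intro P a ha
          have : w • a = 0 := ha
          show w • a ∈ P.map (Submodule.subtype _)
          rw [this]
          exact Submodule.zero_mem _
        rw [sup_eq_right.2 (hle P), sup_eq_right.2 (hle Q)] at h4
        ext ⟨y, a, rfl⟩
        have h5 := SetLike.ext_iff.1 h4 a
        change w • a ∈ P.map (Submodule.subtype _) ↔ w • a ∈ Q.map (Submodule.subtype _) at h5
        have hmem : w • a ∈ (wRange hw : Submodule A M) := ⟨a, rfl⟩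
        simpa [hmem] using h5
    exact ⟨hF.wellFoundedLT.wf⟩
  have h6 := crit_not_artin hM _ h3
  obtain ⟨a, ha⟩ := h0
  apply ha
  have : w • a ∈ (wRange hw : Submodule A M) := ⟨a, rfl⟩
  rw [h6] at this
  simpa using this

theorem sk_prim (s : S) (hs : s ≠ 0) : ∃ (n : ℕ) (g : S), s = φ PowerSeries.X ^ n * g ∧
    skPi hS hα g ≠ 0 ∧ skDeg hS g = skDeg hS s := by
  have key : ∀ (N : ℕ) (s : S), ¬ (PowerSeries.X ^ N ∣ (skRep hS s).leadingCoeff) →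
      ∃ (n : ℕ) (g : S), s = φ PowerSeries.X ^ n * g ∧
        skPi hS hα g ≠ 0 ∧ skDeg hS g = skDeg hS s := by
    intro N
    induction N with
    | zero => intro s h; simp at h
    | succ N ih =>
      intro s h
      by_cases h0 : skPi hS hα s = 0
      · obtain ⟨t, rfl⟩ := skPi_ker hS hα h0
        have h1 : ¬ (PowerSeries.X ^ N ∣ (skRep hS t).leadingCoeff) := by
          intro h2
          apply h
          rw [skRep_φ_mul, Polynomial.leadingCoeff_mul, Polynomial.leadingCoeff_C, pow_succ']
          exact mul_dvd_mul_left _ h2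
        obtain ⟨n, g, rfl, hg, hd⟩ := ih t h1
        refine ⟨n + 1, g, by rw [pow_succ', mul_assoc], hg, ?_⟩
        rw [hd]
        conv_rhs => rw [skDeg, skRep_φ_mul, Polynomial.natDegree_C_mul PowerSeries.X_ne_zero]
        rfl
      · exact ⟨0, s, by simp, h0, rfl⟩
  have hl : (skRep hS s).leadingCoeff ≠ 0 := by simpa using hs
  obtain ⟨m, hm⟩ : ∃ m, PowerSeries.coeff m (skRep hS s).leadingCoeff ≠ 0 := by
    by_contra! hc
    exact hl (PowerSeries.ext (by simpa using hc))
  apply key (m + 1)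
  rw [PowerSeries.X_pow_dvd_iff]
  intro h
  exact hm (h m (by omega))

theorem sk_pdiv (g : S) (hg : g ≠ 0) (h : S) : ∃ (m : ℕ) (a r : S),
    φ PowerSeries.X ^ m * h = a * g + r ∧ (r = 0 ∨ skDeg hS r < skDeg hS g) := by
  induction hd : skDeg hS h using Nat.strong_induction_on generalizing h with
  | _ d ih =>
  by_cases hlt : skDeg hS h < skDeg hS g
  · exact ⟨0, 0, h, by simp, Or.inr hlt⟩
  obtain ⟨j, hj⟩ : ∃ j, skDeg hS h = j + skDeg hS g := ⟨skDeg hS h - skDeg hS g, by omega⟩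
  have hL : (α ^ j : PowerSeries k ≃+* PowerSeries k) (skRep hS g).leadingCoeff ≠ 0 := by
    rw [ne_eq, map_eq_zero_iff _ (RingEquiv.injective _)]
    simpa using hg
  obtain ⟨m, u, hu⟩ := IsDiscreteValuationRing.eq_unit_mul_pow_irreducible hL
    (PowerSeries.X_prime (R := k)).irreducible
  set c := (skRep hS h).leadingCoeff * ((u⁻¹ : (PowerSeries k)ˣ) : PowerSeries k) with hc
  set h1 := φ PowerSeries.X ^ m * h - φ c * θ ^ j * g with hh1
  have e1 : skRep hS (φ PowerSeries.X ^ m * h) = Polynomial.C (PowerSeries.X ^ m) * skRep hS h := by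
    rw [← map_pow, skRep_φ_mul]
  have hco : (skRep hS h1).coeff (skDeg hS h) = 0 := by
    rw [hh1, map_sub, Polynomial.coeff_sub, e1, Polynomial.coeff_C_mul, hj, sk_lead, ← hj, hu, hc]
    have : (skRep hS h).coeff (skDeg hS h) = (skRep hS h).leadingCoeff := rfl
    rw [this]
    have h2 : ((u⁻¹ : (PowerSeries k)ˣ) : PowerSeries k) * u = 1 := by simp
    linear_combination (-(skRep hS h).leadingCoeff * PowerSeries.X ^ m) * h2
  have hle : skDeg hS h1 ≤ skDeg hS h := by
    unfold skDeg
    rw [hh1, map_sub]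
    refine (Polynomial.natDegree_sub_le _ _).trans (max_le ?_ ?_)
    · rw [e1]
      exact Polynomial.natDegree_C_mul_le _ _
    · change skDeg hS (φ c * θ ^ j * g) ≤ skDeg hS h
      refine (skDeg_mul_le hS _ _).trans ?_
      have h3 : skDeg hS (φ c * θ ^ j) ≤ j := by
        have := skRep_eval hS (Polynomial.C c * Polynomial.X ^ j)
        rw [Polynomial.C_mul_X_pow_eq_monomial, Polynomial.eval₂_monomial] at this
        rw [skDeg, this]
        exact Polynomial.natDegree_monomial_le _
      omega
  by_cases h10 : h1 = 0
  · refine ⟨m, φ c * θ ^ j, 0, ?_, Or.inl rfl⟩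
    rw [add_zero]
    exact sub_eq_zero.1 h10
  have hlt' : skDeg hS h1 < skDeg hS h := by
    refine lt_of_le_of_ne hle ?_
    intro heq
    rw [← heq] at hco
    exact skRep_ne hS h10 (Polynomial.leadingCoeff_eq_zero.1 hco)
  obtain ⟨m', a, r, har, hr⟩ := ih (skDeg hS h1) (by omega) h1 rfl
  refine ⟨m' + m, φ PowerSeries.X ^ m' * (φ c * θ ^ j) + a, r, ?_, hr⟩
  have : φ PowerSeries.X ^ m * h = h1 + φ c * θ ^ j * g := by rw [hh1]; abel
  rw [pow_add, mul_assoc, this, mul_add, har, add_mul]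
  simp only [mul_assoc]
  abel

theorem sk_pd {I I' : Submodule S S} (hsat : ∀ s, φ PowerSeries.X * s ∈ I → s ∈ I) {g : S}
    (hg : g ∈ I) (hg0 : g ≠ 0) (hII' : I ≤ I') (hmin : ∀ s ∈ I', s ≠ 0 → skDeg hS g ≤ skDeg hS s)
    (h : S) (hh : h ∈ I') :
    h ∈ I ∧ ∃ m a, φ PowerSeries.X ^ m * h = a * g := by
  obtain ⟨m, a, r, e, hr⟩ := sk_pdiv hS g hg0 h
  have hr' : r ∈ I' := by
    have : r = φ PowerSeries.X ^ m * h - a * g := by rw [e]; abel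
    rw [this]
    exact I'.sub_mem (I'.smul_mem _ hh) (I'.smul_mem _ (hII' hg))
  have hr0 : r = 0 := by
    by_contra hne
    rcases hr with hr | hr
    · exact hne hr
    · exact absurd (hmin r hr' hne) (by omega)
  rw [hr0, add_zero] at e
  refine ⟨?_, m, a, e⟩
  have h1 : φ PowerSeries.X ^ m * h ∈ I := by rw [e]; exact I.smul_mem _ hg
  clear e
  induction m with
  | zero => simpa using h1
  | succ m ih =>
    apply ih
    apply hsat
    rwa [← mul_assoc, ← pow_succ']

include hS in
theorem sk_X_ne : φ PowerSeries.X ≠ 0 := by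
  intro h
  have := skRep_φ hS PowerSeries.X
  rw [h, map_zero, eq_comm, Polynomial.C_eq_zero] at this
  exact PowerSeries.X_ne_zero this

theorem sk_gauss {z : S} (hz : skPi hS hα z ≠ 0) (m : ℕ) (h a : S)
    (e : φ PowerSeries.X ^ m * h = a * z) : ∃ c, h = c * z := by
  have := sk_noZeroDivisors hS
  induction m generalizing a with
  | zero => exact ⟨a, by simpa using e⟩
  | succ m ih =>
    have h1 := congrArg (skPi hS hα) e
    rw [map_mul, map_mul, map_pow, skPi_X, zero_pow (by omega), zero_mul, eq_comm] at h1
    have h2 : skPi hS hα a = 0 := (mul_eq_zero.1 h1).resolve_right hz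
    obtain ⟨t, rfl⟩ := skPi_ker hS hα h2
    apply ih t
    rw [pow_succ', mul_assoc, mul_assoc] at e
    exact mul_left_cancel₀ (sk_X_ne hS) e

theorem sk_principal {I : Submodule S S} (hsat : ∀ s, φ PowerSeries.X * s ∈ I → s ∈ I) {g : S}
    (hg : g ∈ I) (hg0 : g ≠ 0) : ∃ z ∈ I, skPi hS hα z ≠ 0 ∧ ∀ s ∈ I, ∃ c, s = c * z := by
  classical
  have hex : ∃ d, ∃ s ∈ I, s ≠ 0 ∧ skDeg hS s = d := ⟨_, g, hg, hg0, rfl⟩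
  obtain ⟨s, hs, hs0, hsd⟩ := Nat.find_spec hex
  obtain ⟨n, z, hz, hπ, hdz⟩ := sk_prim hS hα s hs0
  have hzI : z ∈ I := by
    rw [hz] at hs
    clear hz
    induction n with
    | zero => simpa using hs
    | succ m ih =>
      apply ih
      apply hsat
      rwa [← mul_assoc, ← pow_succ']
  have hz0 : z ≠ 0 := by
    rintro rfl
    simp at hπ
  refine ⟨z, hzI, hπ, fun t ht => ?_⟩
  obtain ⟨_, m, a, e⟩ := sk_pd hS hsat hzI hz0 le_rfl (by
    intro s' hs' hs0'
    rw [hdz, hsd]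
    exact Nat.find_min' hex ⟨s', hs', hs0', rfl⟩) t ht
  exact sk_gauss hS hα hπ m t a e

theorem sk_unit_mod {K : Submodule S S} {a : S} (ha : a ∈ K) (hu : IsUnit (skPi hS hα a)) (n : ℕ)
    (hn : φ PowerSeries.X ^ n ∈ K) : (1 : S) ∈ K := by
  have hN := skNormal_X hS hα
  obtain ⟨c, hc, hca⟩ := Polynomial.isUnit_iff.1 hu
  have hc0 : c ≠ 0 := hc.ne_zero
  obtain ⟨t, ht⟩ : ∃ t, φ (PowerSeries.C c⁻¹) * a - 1 = φ PowerSeries.X * t := by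
    apply skPi_ker hS hα
    rw [map_sub, map_mul, skPi_φ, ← hca, map_one]
    simp [← Polynomial.C_mul, hc0]
  have h1 : ∀ j : ℕ, ∃ s, 1 - φ PowerSeries.X ^ j * s ∈ K := by
    intro j
    induction j with
    | zero => exact ⟨1, by simp⟩
    | succ j ih =>
      obtain ⟨s, hs⟩ := ih
      obtain ⟨s', hs'⟩ := hN.1 s
      refine ⟨-(s' * t), ?_⟩
      have h2 : φ PowerSeries.X ^ j * s * (φ (PowerSeries.C c⁻¹) * a) ∈ K := by
        rw [← mul_assoc]
        exact K.smul_mem _ ha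
      have h3 := K.add_mem hs h2
      convert h3 using 1
      have : φ (PowerSeries.C c⁻¹) * a = 1 + φ PowerSeries.X * t := by rw [← ht]; abel
      rw [this, mul_add, mul_one, mul_assoc _ s, ← mul_assoc s, hs', pow_succ]
      simp only [mul_assoc, mul_neg]
      abel
  obtain ⟨s, hs⟩ := h1 n
  obtain ⟨s', hs'⟩ := (hN.pow n).2 s
  have h4 := K.add_mem hs (K.smul_mem s' hn)
  rw [smul_eq_mul, hs'] at h4
  simpa using h4

theorem sk_artin {M : Type u} [AddCommGroup M] [Module S M] (e : M) (he : ∀ m, ∃ s : S, s • e = m)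
    (b : S) (hb : b • e = 0) (hu : IsUnit (skPi hS hα b)) : IsArtinian S M := by
  classical
  have hN := skNormal_X hS hα
  have hnt := sk_nontrivial hS
  have hb0 : b ≠ 0 := by rintro rfl; simp at hu
  have hsat : ∀ (N : Submodule S M) (m : M), φ PowerSeries.X • m ∈ N → m ∈ N := by
    intro N m hm
    let I : Submodule S S :=
      { carrier := {s | ∃ n : ℕ, φ PowerSeries.X ^ n • s • e ∈ N}
        zero_mem' := ⟨0, by simp⟩
        add_mem' := by
          rintro a b ⟨n, hn⟩ ⟨m, hm⟩
          refine ⟨n + m, ?_⟩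
          rw [add_smul, smul_add]
          refine N.add_mem ?_ ?_
          · rw [add_comm, pow_add, mul_smul]; exact N.smul_mem _ hn
          · rw [pow_add, mul_smul]; exact N.smul_mem _ hm
        smul_mem' := by
          rintro c s ⟨n, hn⟩
          obtain ⟨c', hc'⟩ := (hN.pow n).2 c
          refine ⟨n, ?_⟩
          rw [smul_eq_mul, mul_smul, smul_smul, hc', ← smul_smul]
          exact N.smul_mem _ hn }
    have hIsat : ∀ s, φ PowerSeries.X * s ∈ I → s ∈ I := by
      rintro s ⟨n, hn⟩
      refine ⟨n + 1, ?_⟩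
      rwa [pow_succ, mul_smul, smul_smul _ s e]
    have hbI : b ∈ I := ⟨0, by rw [hb]; simp⟩
    obtain ⟨z, ⟨n, hn⟩, hπ, hall⟩ := sk_principal hS hα hIsat hbI hb0
    obtain ⟨a, ha⟩ := hall b hbI
    have h1 : (1 : S) ∈ N.comap (LinearMap.toSpanSingleton S M (z • e)) := by
      apply sk_unit_mod hS hα (a := a) _ _ n
      · simpa using hn
      · show a • z • e ∈ N
        rw [smul_smul, ← ha, hb]; exact N.zero_mem
      · rw [ha, map_mul] at hu
        exact isUnit_of_mul_isUnit_left hu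
    have h2 : z • e ∈ N := by simpa using h1
    obtain ⟨s, rfl⟩ := he m
    obtain ⟨c, rfl⟩ := hall s ⟨1, by simpa using hm⟩
    rw [mul_smul]
    exact N.smul_mem _ h2
  have hex : ∀ N : Submodule S M, ∃ d, ∃ s : S, s • e ∈ N ∧ s ≠ 0 ∧ skDeg hS s = d := fun N =>
    ⟨_, b, by rw [hb]; exact N.zero_mem, hb0, rfl⟩
  let μ : Submodule S M → ℕ := fun N => Nat.find (hex N)
  have hle : ∀ N, μ N ≤ skDeg hS b := fun N =>
    Nat.find_min' (hex N) ⟨b, by rw [hb]; exact N.zero_mem, hb0, rfl⟩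
  have hlt : ∀ N N', N < N' → μ N' < μ N := by
    intro N N' hNN
    by_contra! hc
    obtain ⟨s, hs, hs0, hsd⟩ := Nat.find_spec (hex N)
    apply hNN.not_ge
    intro m hm
    obtain ⟨t, rfl⟩ := he m
    refine (sk_pd hS (I := N.comap (LinearMap.toSpanSingleton S M e))
      (I' := N'.comap (LinearMap.toSpanSingleton S M e)) ?_ (g := s) hs hs0 ?_ ?_ t hm).1
    · intro s hs
      apply hsat
      simpa [mul_smul] using hs
    · exact Submodule.comap_mono hNN.le
    · intro s' hs' hs0'
      rw [hsd]
      exact hc.trans (Nat.find_min' (hex N') ⟨s', hs', hs0', rfl⟩)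
  have hF : StrictMono fun N => skDeg hS b - μ N := by
    intro N N' h
    have h1 := hle N
    have h2 := hle N'
    have h3 := hlt N N' h
    show skDeg hS b - μ N < skDeg hS b - μ N'
    omega
  exact ⟨hF.wellFoundedLT.wf⟩

theorem ps_finite {M : Type u} [AddCommGroup M] [Module (PowerSeries k) M] (d : ℕ) (v : ℕ → M)
    (step : ∀ m : M, ∃ (c : ℕ → k) (m' : M), m = ∑ i ∈ Finset.range d, PowerSeries.C (c i) • v i +
      (PowerSeries.X : PowerSeries k) • m')
    (haus : ∀ m : M, (∀ n : ℕ, ∃ m', (PowerSeries.X : PowerSeries k) ^ n • m' = m) → m = 0) :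
    Module.Finite (PowerSeries k) M := by
  classical
  choose c nx hnx using step
  let r : M → ℕ → PowerSeries k := fun m i => PowerSeries.mk fun n => c (nx^[n] m) i
  have hr : ∀ m i, r m i = PowerSeries.C (c m i) + PowerSeries.X * r (nx m) i := by
    intro m i
    ext n
    cases n with
    | zero => simp [r]
    | succ n => simp [r, PowerSeries.coeff_succ_X_mul]
  let F : M → M := fun m => ∑ i ∈ Finset.range d, r m i • v i
  have hF : ∀ m, m - F m = (PowerSeries.X : PowerSeries k) • (nx m - F (nx m)) := by
    intro m
    have : F m = ∑ i ∈ Finset.range d, PowerSeries.C (c m i) • v i +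
        (PowerSeries.X : PowerSeries k) • F (nx m) := by
      simp only [F]
      rw [Finset.smul_sum, ← Finset.sum_add_distrib]
      refine Finset.sum_congr rfl fun i _ => ?_
      rw [hr m i, add_smul, mul_smul]
    rw [this]
    have h2 := hnx m
    rw [smul_sub, sub_eq_iff_eq_add]
    refine h2.trans ?_
    abel
  have hall : ∀ (n : ℕ) (m : M), ∃ m', (PowerSeries.X : PowerSeries k) ^ n • m' = m - F m := by
    intro n
    induction n with
    | zero => intro m; exact ⟨m - F m, by simp⟩
    | succ n ih =>
      intro m
      obtain ⟨m', h⟩ := ih (nx m)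
      exact ⟨m', by rw [hF, ← h, smul_smul, pow_succ']⟩
  refine ⟨⟨(Finset.range d).image v, ?_⟩⟩
  rw [eq_top_iff]
  intro m _
  have h1 : m = F m := sub_eq_zero.1 (haus _ fun n => hall n m)
  rw [h1]
  refine Submodule.sum_mem _ fun i hi => Submodule.smul_mem _ _ (Submodule.subset_span ?_)
  simp only [Finset.coe_image]
  exact ⟨i, hi, rfl⟩

theorem ps_nak {M : Type u} [AddCommGroup M] [Module (PowerSeries k) M]
    [Module.Finite (PowerSeries k) M] (N : Submodule (PowerSeries k) M)
    (h : ∀ m : M, ∃ n ∈ N, ∃ m', m = n + (PowerSeries.X : PowerSeries k) • m') (m : M) : m ∈ N := by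
  have h1 : (⊤ : Submodule (PowerSeries k) M) ≤ N := by
    apply Submodule.le_of_le_smul_of_le_jacobson_bot (I := IsLocalRing.maximalIdeal (PowerSeries k))
      Module.Finite.fg_top (IsLocalRing.maximalIdeal_le_jacobson _)
    intro m _
    obtain ⟨n, hn, m', rfl⟩ := h m
    refine Submodule.add_mem_sup hn (Submodule.smul_mem_smul ?_ trivial)
    rw [IsLocalRing.mem_maximalIdeal, mem_nonunits_iff]
    exact PowerSeries.X_prime.not_isUnit
  exact h1 trivial

include hS hα in
theorem sk_core {M : Type u} [AddCommGroup M] [Module S M] (e : M) (he : ∀ m, ∃ s : S, s • e = m)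
    (hfaith : FaithfulSMul S M) (hM : IsOneCritical S M) :
    ∃ z : S, Irreducible z ∧ (∃ (p : Polynomial k) (s : S), p.Monic ∧ 1 ≤ p.natDegree ∧
      z = thetaPoly φ θ p + φ PowerSeries.X * s ∧ z ≠ θ) ∧
      ∀ s : S, s • e = 0 ↔ ∃ c, s = c * z := by
  have hnz := sk_noZeroDivisors hS
  have hnt := sk_nontrivial hS
  have hN := skNormal_X hS hα
  have hNθ := skNormal_θ hS
  have hf : ∀ s : S, s ≠ 0 → ∃ m : M, s • m ≠ 0 := by
    intro s hs
    by_contra! hc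
    exact hs (hfaith.eq_of_smul_eq_smul (fun m => by rw [hc, zero_smul]))
  have hinj : ∀ m : M, φ PowerSeries.X • m = 0 → m = 0 :=
    crit_inj hM hN (hf _ (sk_X_ne hS))
  -- nonzero annihilator
  obtain ⟨g, hg, hg0⟩ : ∃ g : S, g • e = 0 ∧ g ≠ 0 := by
    by_contra! hc
    have hR : (wRange hN : Submodule S M) ≠ ⊥ := by
      intro h
      obtain ⟨m, hm⟩ := hf _ (sk_X_ne hS)
      have : φ PowerSeries.X • m ∈ (wRange hN : Submodule S M) := ⟨m, rfl⟩
      rw [h] at this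
      exact hm (by simpa using this)
    have hart := hM.2.2 _ hR
    obtain ⟨q, hq⟩ := artin_surj hNθ (M := M ⧸ (wRange hN : Submodule S M)) (by
      intro m hm
      obtain ⟨m, rfl⟩ := Submodule.mkQ_surjective _ m
      rw [← map_smul, Submodule.mkQ_apply, Submodule.Quotient.mk_eq_zero] at hm
      obtain ⟨m', hm'⟩ := hm
      obtain ⟨s, rfl⟩ := he m
      obtain ⟨s', rfl⟩ := he m'
      have h1 : φ PowerSeries.X * s' - θ * s = 0 := by
        apply hc
        rw [sub_smul, mul_smul, mul_smul, hm', sub_self]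
      have h2 := congrArg (skPi hS hα) h1
      rw [map_sub, map_mul, map_mul, skPi_X, skPi_θ, map_zero, zero_mul, zero_sub, neg_eq_zero,
        mul_eq_zero] at h2
      obtain ⟨t, rfl⟩ := skPi_ker hS hα (h2.resolve_left Polynomial.X_ne_zero)
      rw [Submodule.mkQ_apply, Submodule.Quotient.mk_eq_zero]
      exact ⟨t • e, by rw [smul_smul]⟩) (Submodule.mkQ _ e)
    obtain ⟨m, rfl⟩ := Submodule.mkQ_surjective _ q
    rw [← map_smul, ← sub_eq_zero, ← map_sub, Submodule.mkQ_apply,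
      Submodule.Quotient.mk_eq_zero] at hq
    obtain ⟨m', hm'⟩ := hq
    obtain ⟨s, rfl⟩ := he m
    obtain ⟨s', rfl⟩ := he m'
    have h1 : φ PowerSeries.X * s' - (θ * s - 1) = 0 := by
      apply hc
      rw [sub_smul, sub_smul, mul_smul, mul_smul, hm', one_smul, sub_self]
    have h2 := congrArg (skPi hS hα) h1
    rw [map_sub, map_sub, map_mul, map_mul, skPi_X, skPi_θ, map_zero, zero_mul, zero_sub,
      neg_eq_zero, map_one] at h2
    have h3 := congrArg (Polynomial.eval 0) h2
    simp at h3
  -- no divisible part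
  have hD : ∀ m : M, (∀ n : ℕ, ∃ m', φ PowerSeries.X ^ n • m' = m) → m = 0 := by
    let D : Submodule S M := ⨅ n : ℕ, wRange (hN.pow n)
    have hmem : ∀ m : M, m ∈ D ↔ ∀ n : ℕ, ∃ m', φ PowerSeries.X ^ n • m' = m := by
      intro m
      simp only [D, Submodule.mem_iInf]
      rfl
    have hdiv : ∀ m : M, φ PowerSeries.X • m ∈ D → m ∈ D := by
      intro m hm
      rw [hmem] at hm ⊢
      intro n
      obtain ⟨m', h⟩ := hm (n + 1)
      refine ⟨m', ?_⟩
      rw [← sub_eq_zero]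
      apply hinj
      rw [smul_sub, smul_smul, ← pow_succ', h, sub_self]
    have hart : IsArtinian S D := by
      obtain ⟨c, hcD, hcπ, hall⟩ := sk_principal hS hα
        (I := D.comap (LinearMap.toSpanSingleton S M e)) (by
          intro s hs
          apply hdiv
          simpa [mul_smul] using hs) (g := g) (by simp [hg]) hg0
      have hce : c • e ∈ D := hcD
      obtain ⟨m', hm'⟩ := (hmem _).1 hce 1
      rw [pow_one] at hm'
      have hm'D : m' ∈ D := hdiv _ (by rw [hm']; exact hce)
      obtain ⟨t, rfl⟩ := he m'
      obtain ⟨t', rfl⟩ := hall t hm'D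
      refine sk_artin hS hα (⟨c • e, hce⟩ : D) ?_ (1 - φ PowerSeries.X * t') ?_ ?_
      · rintro ⟨m, hm⟩
        obtain ⟨s, rfl⟩ := he m
        obtain ⟨s', rfl⟩ := hall s hm
        exact ⟨s', by ext; simp [mul_smul]⟩
      · ext
        simp only [Submodule.coe_smul, Submodule.coe_zero]
        rw [sub_smul, one_smul, mul_smul, smul_smul t', hm', sub_self]
      · rw [map_sub, map_mul, skPi_X, map_one, zero_mul, sub_zero]
        exact isUnit_one
    have hbot := crit_not_artin hM D hart
    intro m hm
    have := (hmem m).2 hm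
    rw [hbot] at this
    simpa using this
  -- the generator
  obtain ⟨z, hz, hann⟩ : ∃ z : S, (skPi hS hα z).Monic ∧
      ∀ s : S, s • e = 0 ↔ ∃ c, s = c * z := by
    obtain ⟨z, hz, hzπ, hall⟩ := sk_principal hS hα
      (I := (⊥ : Submodule S M).comap (LinearMap.toSpanSingleton S M e)) (by
          intro s hs
          have : φ PowerSeries.X • s • e = 0 := by simpa [mul_smul] using hs
          simpa using hinj _ this) (g := g) (by simp [hg]) hg0
    have hze : z • e = 0 := by simpa using hz
    set l := (skPi hS hα z).leadingCoeff with hl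
    have hl0 : l ≠ 0 := by simpa [hl] using hzπ
    refine ⟨φ (PowerSeries.C l⁻¹) * z, ?_, fun s => ⟨fun hs => ?_, ?_⟩⟩
    · rw [map_mul, skPi_φ, Polynomial.Monic, Polynomial.leadingCoeff_mul, ← hl]
      simp [hl0]
    · obtain ⟨c, rfl⟩ := hall s (by simpa using hs)
      refine ⟨c * φ (PowerSeries.C l), ?_⟩
      rw [mul_assoc, ← mul_assoc (φ _), ← map_mul, ← map_mul]
      simp [hl0]
    · rintro ⟨c, rfl⟩
      rw [mul_smul, mul_smul, hze, smul_zero, smul_zero]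
  have hze : z • e = 0 := (hann z).2 ⟨1, by simp⟩
  have hzne : skPi hS hα z ≠ 0 := hz.ne_zero
  have hz0 : z ≠ 0 := by rintro rfl; simp at hzne
  have hdeg : 1 ≤ (skPi hS hα z).natDegree := by
    by_contra! hlt
    have h1 : skPi hS hα z = 1 := hz.natDegree_eq_zero.1 (by omega)
    exact hM.2.1 (sk_artin hS hα e he z hze (by rw [h1]; exact isUnit_one))
  have hsub : ∀ p : Polynomial k, ∀ s : S, skPi hS hα s = p →
      ∃ t, s = thetaPoly φ θ p + φ PowerSeries.X * t := by
    intro p s hs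
    obtain ⟨t, ht⟩ := skPi_ker hS hα (s := s - thetaPoly φ θ p) (by
      rw [map_sub, skPi_thetaPoly, hs, sub_self])
    exact ⟨t, by rw [← ht]; abel⟩
  letI : Module (PowerSeries k) M := Module.compHom M φ
  have hsm : ∀ (r : PowerSeries k) (m : M), r • m = φ r • m := fun _ _ => rfl
  have hfin : Module.Finite (PowerSeries k) M := by
    apply ps_finite (skPi hS hα z).natDegree (fun i => θ ^ i • e)
    · intro m
      obtain ⟨s, rfl⟩ := he m
      set p := skPi hS hα z with hp
      set q := skPi hS hα s /ₘ p with hq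
      set r := skPi hS hα s %ₘ p with hr
      have hqr : r + p * q = skPi hS hα s := Polynomial.modByMonic_add_div _ _
      obtain ⟨t, ht⟩ := hsub r (s - thetaPoly φ θ q * z) (by
        rw [map_sub, map_mul, skPi_thetaPoly, ← hqr, ← hp]; ring)
      refine ⟨r.coeff, t • e, ?_⟩
      have h1 : s • e = (s - thetaPoly φ θ q * z) • e := by
        rw [sub_smul, mul_smul, hze, smul_zero, sub_zero]
      rw [h1, ht, add_smul, mul_smul, hsm]
      congr 1
      have hrd : r.natDegree < p.natDegree := by
        apply Polynomial.natDegree_modByMonic_lt _ hz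
        intro h
        rw [h] at hdeg
        simp at hdeg
      unfold thetaPoly
      rw [Polynomial.sum_over_range' _ _ _ hrd, Finset.sum_smul]
      · refine Finset.sum_congr rfl fun i _ => ?_
        rw [mul_smul, hsm]
        rfl
      · intro n; simp
    · intro m hm
      apply hD
      intro n
      obtain ⟨m', h⟩ := hm n
      exact ⟨m', by rw [← h, hsm, map_pow]⟩
  have hleft : ∀ a b : S, a * b = 1 → IsUnit b := by
    intro a b hab
    have hb0 : b ≠ 0 := by rintro rfl; simp at hab
    have : b * a = 1 := by
      apply mul_right_cancel₀ hb0
      rw [mul_assoc, hab, mul_one, one_mul]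
    exact ⟨⟨b, a, this, hab⟩, rfl⟩
  obtain ⟨s, hs⟩ := hsub _ z rfl
  refine ⟨z, ⟨?_, ?_⟩, ⟨skPi hS hα z, s, hz, hdeg, hs, ?_⟩, hann⟩
  · intro hu
    have := (hu.map (skPi hS hα))
    have := Polynomial.natDegree_eq_zero_of_isUnit this
    omega
  · intro a b hab
    by_contra! hc
    obtain ⟨ha, hb⟩ := hc
    have ha0 : a ≠ 0 := by rintro rfl; simp [hz0] at hab
    have hb0 : b ≠ 0 := by rintro rfl; simp [hz0] at hab
    have hπb : skPi hS hα b ≠ 0 := by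
      intro h
      rw [hab, map_mul, h, mul_zero] at hzne
      exact hzne rfl
    have hbe : b • e ≠ 0 := by
      intro h
      obtain ⟨c, hc⟩ := (hann b).1 h
      apply ha
      apply hleft c a
      apply mul_right_cancel₀ hb0
      rw [mul_assoc, ← hab, ← hc, one_mul]
    let N : Submodule S M := Submodule.span S {b • e}
    have hNmem : ∀ s : S, s • e ∈ N ↔ ∃ c, s = c * b := by
      intro s
      simp only [N, Submodule.mem_span_singleton]
      constructor
      · rintro ⟨c, hc⟩
        obtain ⟨c', hc'⟩ := (hann (s - c * b)).1 (by rw [sub_smul, mul_smul, hc, sub_self])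
        refine ⟨c' * a + c, ?_⟩
        rw [add_mul, mul_assoc, ← hab, ← hc']; abel
      · rintro ⟨c, rfl⟩
        exact ⟨c, by rw [mul_smul]⟩
    have hart := hM.2.2 N (by
      intro h
      have : b • e ∈ N := Submodule.mem_span_singleton_self _
      rw [h] at this
      exact hbe (by simpa using this))
    have hsurj := artin_surj hN (M := M ⧸ N) (by
      intro m hm
      obtain ⟨m, rfl⟩ := Submodule.mkQ_surjective _ m
      rw [← map_smul, Submodule.mkQ_apply, Submodule.Quotient.mk_eq_zero] at hm
      obtain ⟨s, rfl⟩ := he m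
      rw [smul_smul, hNmem] at hm
      obtain ⟨c, hc⟩ := hm
      rw [Submodule.mkQ_apply, Submodule.Quotient.mk_eq_zero, hNmem]
      exact sk_gauss hS hα hπb 1 s c (by rw [pow_one, hc]))
    let N' : Submodule (PowerSeries k) M :=
      { carrier := N
        zero_mem' := N.zero_mem
        add_mem' := N.add_mem
        smul_mem' := fun r m hm => N.smul_mem (φ r) hm }
    have hall := ps_nak N' (by
      intro m
      obtain ⟨q, hq⟩ := hsurj (N.mkQ m)
      obtain ⟨m', rfl⟩ := Submodule.mkQ_surjective _ q
      rw [← map_smul, eq_comm, ← sub_eq_zero, ← map_sub, Submodule.mkQ_apply,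
        Submodule.Quotient.mk_eq_zero] at hq
      exact ⟨_, hq, m', by rw [hsm]; abel⟩) e
    have h1 : (1 : S) • e ∈ N := by rw [one_smul]; exact hall
    obtain ⟨c, hc⟩ := (hNmem 1).1 h1
    exact hb (hleft c b hc.symm)
  · rintro rfl
    obtain ⟨m, hm⟩ := hf z hz0
    obtain ⟨s, rfl⟩ := he m
    obtain ⟨s', hs'⟩ := hNθ.2 s
    apply hm
    rw [smul_smul, hs', mul_smul, hze, smul_zero]

theorem sk_op (hS : IsSkewPolynomialRing α φ θ) :
    IsSkewPolynomialRing α.symm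
      (φ.toOpposite fun x y => by
        show φ x * φ y = φ y * φ x
        rw [← map_mul, mul_comm, map_mul]) (op θ) := by
  constructor
  · intro r
    show op (φ r * θ) = op (θ * φ (α.symm r))
    rw [hS.commutes, RingEquiv.apply_symm_apply]
  · have hpow : ∀ (n : ℕ) (r : PowerSeries k),
        θ ^ n * φ r = φ ((α ^ n : PowerSeries k ≃+* PowerSeries k) r) * θ ^ n := by
      intro n
      induction n with
      | zero => intro r; simp
      | succ n ih =>
        intro r
        rw [pow_succ, mul_assoc, hS.commutes, ← mul_assoc, ih, mul_assoc]
        congr 2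
    let T : (ℕ →₀ PowerSeries k) → (ℕ →₀ PowerSeries k) := fun f =>
      Finsupp.mk f.support (fun n => (α ^ n : PowerSeries k ≃+* PowerSeries k) (f n)) (by
        intro a
        rw [Finsupp.mem_support_iff, ne_eq, ne_eq, (α ^ a : PowerSeries k ≃+* PowerSeries k).map_eq_zero_iff])
    have hT : Function.Bijective T := by
      constructor
      · intro f g h
        ext1 n
        exact (α ^ n : PowerSeries k ≃+* PowerSeries k).injective (DFunLike.congr_fun h n)
      · intro f
        refine ⟨Finsupp.mk f.support
          (fun n => (α ^ n : PowerSeries k ≃+* PowerSeries k).symm (f n)) (by simp), ?_⟩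
        ext1 n
        exact RingEquiv.apply_symm_apply _ _
    have h := (MulOpposite.opEquiv (α := S)).bijective.comp (hS.bijective.comp hT)
    convert h using 1
    funext f
    show f.sum _ = op ((T f).sum fun n r => φ r * θ ^ n)
    rw [Finsupp.sum, Finsupp.sum]
    rw [Finset.op_sum]
    refine Finset.sum_congr rfl fun n _ => ?_
    show op (θ ^ n * φ (f n)) = op (φ ((α ^ n : PowerSeries k ≃+* PowerSeries k) (f n)) * θ ^ n)
    rw [hpow]

end SkewAux
/-- Let `I` be a left ideal of `Ŝ = k[[X]][θ; α]` (`α` of infinite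
order) such that `Ŝ/I` is a faithful 1-critical left `Ŝ`-module.  Then `I = Ŝz` for an
irreducible element `z` of `Ŝ`, necessarily of type (C); and the analogous statement
holds for right ideals. -/
theorem faithful_one_critical_cyclic_is_principal
    {k : Type u} [Field k] (α : PowerSeries k ≃ₐ[k] PowerSeries k)
    (hord : ∀ n : ℕ, 0 < n → α ^ n ≠ 1)
    {S : Type u} [Ring S] (φ : PowerSeries k →+* S) (θ : S)
    (hS : IsSkewPolynomialRing α.toRingEquiv φ θ) :
    (∀ I : Submodule S S, FaithfulSMul S (S ⧸ I) → IsOneCritical S (S ⧸ I) →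
      ∃ z : S, Irreducible z ∧ IsTypeC k PowerSeries.X φ θ z ∧ I = lSpan S z) ∧
    (∀ J : Submodule Sᵐᵒᵖ S, FaithfulSMul Sᵐᵒᵖ (S ⧸ J) → IsOneCritical Sᵐᵒᵖ (S ⧸ J) →
      ∃ z : S, Irreducible z ∧ IsTypeC k PowerSeries.X φ θ z ∧ J = rSpan S z) := by
  have hα : ∀ c, α.toRingEquiv (PowerSeries.C c) = PowerSeries.C c := fun c => α.commutes c
  have hα' : ∀ c, α.toRingEquiv.symm (PowerSeries.C c) = PowerSeries.C c := by
    intro c; rw [RingEquiv.symm_apply_eq, hα]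
  constructor
  · intro I hfaith hcrit
    obtain ⟨z, hirr, ⟨p, s, hp, hd, hz, hne⟩, hann⟩ :=
      sk_core hS hα (M := S ⧸ I) (Submodule.Quotient.mk 1) (by
        intro m
        obtain ⟨s, rfl⟩ := Submodule.Quotient.mk_surjective _ m
        exact ⟨s, by rw [← Submodule.Quotient.mk_smul, smul_eq_mul, mul_one]⟩) hfaith hcrit
    refine ⟨z, hirr, ⟨1, p, s, hp, hd, by simpa using hz, by simpa using hne⟩, ?_⟩
    ext t
    have h := hann t
    rw [← Submodule.Quotient.mk_smul, Submodule.Quotient.mk_eq_zero, smul_eq_mul, mul_one] at h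
    rw [h, Submodule.mem_span_singleton]
    exact exists_congr fun c => eq_comm
  · intro J hfaith hcrit
    obtain ⟨z, hirr, ⟨p, s, hp, hd, hz, hne⟩, hann⟩ :=
      sk_core (sk_op hS) hα' (M := S ⧸ J) (Submodule.Quotient.mk 1) (by
        intro m
        obtain ⟨s, rfl⟩ := Submodule.Quotient.mk_surjective _ m
        exact ⟨op s, by rw [← Submodule.Quotient.mk_smul, op_smul_eq_mul, one_mul]⟩) hfaith hcrit
    obtain ⟨s', hs'⟩ := (skNormal_X hS hα).1 (unop s)
    have hc : ∀ (c : k) (n : ℕ), θ ^ n * φ (PowerSeries.C c) = φ (PowerSeries.C c) * θ ^ n := by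
      intro c n
      have h1 : Commute θ (φ (PowerSeries.C c)) := by
        have := hS.commutes (PowerSeries.C c)
        rwa [hα] at this
      exact h1.pow_left n
    have hz' : unop z = thetaPoly φ θ p + φ PowerSeries.X * s' := by
      rw [hz, ← hs', unop_add]
      congr 1
      unfold thetaPoly
      rw [Polynomial.sum, Polynomial.sum, Finset.unop_sum]
      exact Finset.sum_congr rfl fun n _ => hc _ n
    refine ⟨unop z, ⟨?_, ?_⟩, ⟨1, p, s', hp, hd, by simpa using hz', ?_⟩, ?_⟩
    · intro h
      exact hirr.not_isUnit (isUnit_unop.1 h)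
    · intro a b hab
      have := hirr.isUnit_or_isUnit (a := op b) (b := op a) (by rw [← op_mul, ← hab, op_unop])
      rw [isUnit_op, isUnit_op] at this
      exact this.symm
    · rw [Units.val_one, one_mul]
      intro h
      exact hne (by rw [← h, op_unop])
    · ext t
      have h := hann (op t)
      rw [← Submodule.Quotient.mk_smul, Submodule.Quotient.mk_eq_zero, op_smul_eq_mul,
        one_mul] at h
      rw [h, Submodule.mem_span_singleton]
      constructor
      · rintro ⟨c, hc⟩
        exact ⟨c, by
          have := congrArg unop hc
          rw [unop_op, unop_mul] at this
          rw [this]; rfl⟩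
      · rintro ⟨c, rfl⟩
        exact ⟨c, rfl⟩
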